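/- Let A be a traceless operator on the first k' sites with ‖A‖ = 1 and let f : [−1,1] → {z ∈ ℂ : |z| ≤ 1} be a smooth function. If there exists a strictly increasing sequence (N_i) of positive integers such that r_f(N_i) → 0 as i → ∞, then f(0) = 0. -/

import Mathlib

open Matrix MeasureTheory Filter

/-- The space of operators on a chain of `N` qudits, each of local dimension `dloc`. -/
abbrev Op (dloc N : ℕ) := Matrix (Fin N → Fin dloc) (Fin N → Fin dloc) ℂ

/-- Cyclic translation of qudit configurations: site `i` of the new configuration carries
the value of site `i - 1` of the old one. -/
def confShift (dloc N : ℕ) : Equiv.Perm (Fin N → Fin dloc) :=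
  Equiv.arrowCongr (finRotate N) (Equiv.refl (Fin dloc))

/-- The translation operator `T` on a chain of `N` qudits, as a permutation matrix. -/
noncomputable def Tmat (dloc N : ℕ) : Op dloc N :=
  fun x y => if x = confShift dloc N y then 1 else 0

/-- Extension of an operator on the first `m` sites to the `N`-site chain, by tensoring
with the identity on the remaining sites (the zero operator if `m > N`). -/
noncomputable def embed (dloc m N : ℕ) (a : Op dloc m) : Op dloc N :=
  if hm : m ≤ N then
    (fun x y => a (fun i => x (Fin.castLE hm i)) (fun i => y (Fin.castLE hm i)) *
      (if ∀ i : Fin N, m ≤ (i : ℕ) → x i = y i then 1 else 0))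
  else 0

/-- The translation-invariant Hamiltonian `H_N = ∑_{l=0}^{N-1} T^l h T^{-l}` built from
a local term `h` on `k` sites. -/
noncomputable def Ham (dloc k N : ℕ) (h : Op dloc k) : Op dloc N :=
  ∑ l : Fin N, Tmat dloc N ^ (l : ℕ) * embed dloc k N h * (Tmat dloc N)ᴴ ^ (l : ℕ)

/-- The operator norm (ℓ²→ℓ² norm) of a matrix. -/
noncomputable def opNorm {n : Type*} [Fintype n] [DecidableEq n] (A : Matrix n n ℂ) : ℝ :=
  ‖Matrix.toEuclideanCLM (𝕜 := ℂ) (n := n) A‖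

/-- An orthonormal basis of simultaneous eigenvectors of the Hamiltonian `H` (with real
eigenvalues `E j`) and of the translation operator `T` (with eigenvalues `τ j`). -/
structure EigData (dloc N : ℕ) (H : Op dloc N) where
  v : (Fin N → Fin dloc) → ((Fin N → Fin dloc) → ℂ)
  E : (Fin N → Fin dloc) → ℝ
  τ : (Fin N → Fin dloc) → ℂ
  orth : ∀ j j', star (v j) ⬝ᵥ v j' = if j = j' then 1 else 0
  eigH : ∀ j, H.mulVec (v j) = (E j : ℂ) • v j
  eigT : ∀ j, (Tmat dloc N).mulVec (v j) = τ j • v j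

/-- The eigenstate expectation value `⟨j|B|j⟩`. -/
noncomputable def eev {dloc N : ℕ} {H : Op dloc N} (D : EigData dloc N H)
    (B : Op dloc N) (j : Fin N → Fin dloc) : ℂ :=
  star (D.v j) ⬝ᵥ B.mulVec (D.v j)

/-- `r_f(N) = ((1/d) ∑_j |⟨j|B|j⟩ - f(E_j/N)|²)^{1/2}`. -/
noncomputable def rf {dloc N : ℕ} {H : Op dloc N} (D : EigData dloc N H)
    (B : Op dloc N) (f : ℝ → ℂ) : ℝ :=
  Real.sqrt ((1 / (dloc : ℝ) ^ N) * ∑ j, ‖eev D B j - f (D.E j / N)‖ ^ 2)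

/-- A function `f : [-1,1] → {z : ℂ, |z| ≤ 1}` (encoded as a total function on `ℝ`)
is smooth with Taylor data `c0 = f(0)`, `c1 = f'(0)`, `c2 = f''(0)` and remainder
constant `M` if `|f(x) - c0 - c1 x - (c2/2) x²| ≤ M |x|³` on `[-1,1]`. -/
def SmoothFn (f : ℝ → ℂ) (c0 c1 c2 : ℂ) (M : ℝ) : Prop :=
  0 ≤ M ∧ (∀ x ∈ Set.Icc (-1 : ℝ) 1, ‖f x‖ ≤ 1) ∧
    ∀ x ∈ Set.Icc (-1 : ℝ) 1, ‖f x - c0 - c1 * x - c2 / 2 * x ^ 2‖ ≤ M * |x| ^ 3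

/-- The generalized Pauli string `X^{a_1}Z^{b_1} ⊗ ⋯ ⊗ X^{a_m}Z^{b_m}` on `m` qudits,
where `X|x⟩ = |x+1 mod dloc⟩` and `Z|x⟩ = ω^x |x⟩` with `ω = exp(2πi/dloc)`. -/
noncomputable def pauli (dloc m : ℕ) (a b : Fin m → Fin dloc) : Op dloc m :=
  fun x y =>
    if ∀ i, (x i : ℕ) = ((y i : ℕ) + (a i : ℕ)) % dloc then
      ∏ i, Complex.exp (2 * Real.pi * Complex.I * (b i : ℕ) * (y i : ℕ) / dloc)
    else 0

/-- An operator on `k` sites is canonical if every generalized Pauli string with nonzero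
coefficient in its expansion acts nontrivially on site 1. -/
def Canonical (dloc k : ℕ) (h : Op dloc k) : Prop :=
  ∀ a b : Fin k → Fin dloc,
    (∀ i : Fin k, (i : ℕ) = 0 → (a i : ℕ) = 0 ∧ (b i : ℕ) = 0) →
      Matrix.trace ((pauli dloc k a b)ᴴ * h) = 0

/-- An operator on `k` sites is exactly `k`-local if some generalized Pauli string with
nonzero coefficient in its expansion acts nontrivially on site `k`. -/
def ExactlyLocal (dloc k : ℕ) (h : Op dloc k) : Prop :=
  ∃ a b : Fin k → Fin dloc, ∃ i : Fin k, (i : ℕ) = k - 1 ∧ ((a i : ℕ) ≠ 0 ∨ (b i : ℕ) ≠ 0) ∧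
    Matrix.trace ((pauli dloc k a b)ᴴ * h) ≠ 0

/-- The submodule (over `ℝ`) of traceless operators on `k'` sites. -/
noncomputable def tracelessOps (dloc k' : ℕ) : Submodule ℝ (Op dloc k') :=
  LinearMap.ker ((Matrix.traceLinearMap (Fin k' → Fin dloc) ℂ ℂ).restrictScalars ℝ)

/-- The translation average `𝔸 = (1/N) ∑_{l=0}^{N-1} T^l A T^{-l}` of an operator. -/
noncomputable def tavg (dloc N : ℕ) (A : Op dloc N) : Op dloc N :=
  ((N : ℂ))⁻¹ • ∑ l : Fin N, Tmat dloc N ^ (l : ℕ) * A * (Tmat dloc N)ᴴ ^ (l : ℕ)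

section ChainOperators

variable {dloc m k N n : ℕ}

theorem eq_confShift_iff (x y : Fin N → Fin dloc) :
    x = confShift dloc N y ↔ y = x ∘ finRotate N := by
  rw [← Equiv.symm_apply_eq, eq_comm]
  rfl

theorem Tmat_mul_apply (B : Op dloc N) (x y : Fin N → Fin dloc) :
    (Tmat dloc N * B) x y = B (x ∘ finRotate N) y := by
  simp [Matrix.mul_apply, Tmat, eq_confShift_iff]

theorem mul_Tmat_conjTranspose_apply (B : Op dloc N) (x y : Fin N → Fin dloc) :
    (B * (Tmat dloc N)ᴴ) x y = B x (y ∘ finRotate N) := by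
  simp [Matrix.mul_apply, Tmat, eq_confShift_iff, Matrix.conjTranspose_apply, apply_ite]

theorem Tmat_mul_conjTranspose : Tmat dloc N * (Tmat dloc N)ᴴ = 1 := by
  ext x y
  rw [← mul_one (Tmat dloc N), Matrix.conjTranspose_mul, Matrix.conjTranspose_one, one_mul,
    mul_Tmat_conjTranspose_apply, Tmat_mul_apply, Matrix.one_apply, Matrix.one_apply]
  simp only [(finRotate N).surjective.right_cancellable]

theorem conjTranspose_mul_Tmat : (Tmat dloc N)ᴴ * Tmat dloc N = 1 :=
  mul_eq_one_comm.mp Tmat_mul_conjTranspose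

theorem Tmat_pow_succ_conj (B : Op dloc N) (l : ℕ) :
    Tmat dloc N ^ (l + 1) * B * (Tmat dloc N)ᴴ ^ (l + 1) =
      Tmat dloc N * (Tmat dloc N ^ l * B * (Tmat dloc N)ᴴ ^ l) * (Tmat dloc N)ᴴ := by
  rw [pow_succ', pow_succ]
  simp only [mul_assoc]

/-- Conjugating by powers of the translation operator relabels the sites. -/
theorem Tmat_pow_conj_apply (B : Op dloc N) (l : ℕ) (x y : Fin N → Fin dloc) :
    (Tmat dloc N ^ l * B * (Tmat dloc N)ᴴ ^ l) x y =
      B (x ∘ (finRotate N)^[l]) (y ∘ (finRotate N)^[l]) := by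
  induction l generalizing x y with
  | zero => simp
  | succ l ih =>
    rw [Tmat_pow_succ_conj, mul_Tmat_conjTranspose_apply, Tmat_mul_apply, ih, Function.iterate_succ']
    rfl

theorem coe_finRotate_iterate (l : ℕ) (i : Fin N) :
    (((finRotate N)^[l] i : Fin N) : ℕ) = (i + l) % N := by
  induction l with
  | zero => simp [Nat.mod_eq_of_lt i.isLt]
  | succ l ih =>
    have := i.neZero
    rw [Function.iterate_succ_apply', finRotate_apply, Fin.val_add, ih, Fin.val_one',
      ← Nat.add_mod, add_assoc]

theorem embed_apply (hm : m ≤ N) (a : Op dloc m) (x y : Fin N → Fin dloc) :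
    embed dloc m N a x y =
      a (fun i => x (Fin.castLE hm i)) (fun i => y (Fin.castLE hm i)) *
        (if ∀ i : Fin N, m ≤ (i : ℕ) → x i = y i then 1 else 0) := by
  have h : embed dloc m N a = Matrix.of fun x y =>
      a (fun i => x (Fin.castLE hm i)) (fun i => y (Fin.castLE hm i)) *
        (if ∀ i : Fin N, m ≤ (i : ℕ) → x i = y i then 1 else 0) := dif_pos hm
  rw [h, Matrix.of_apply]

theorem embed_append (a : Op dloc m) (x x' : Fin m → Fin dloc) (y y' : Fin n → Fin dloc) :
    embed dloc m (m + n) a (Fin.append x y) (Fin.append x' y') =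
      a x x' * (1 : Matrix _ _ ℂ) y y' := by
  have h1 : (∀ i : Fin (m + n), m ≤ (i : ℕ) → Fin.append x y i = Fin.append x' y' i) ↔ y = y' := by
    constructor
    · intro H
      funext i
      simpa using H (Fin.natAdd m i) (by simp)
    · rintro rfl i hi
      induction i using Fin.addCases with
      | left i => simp at hi; omega
      | right i => simp
  have h2 (z : Fin m → Fin dloc) (w : Fin n → Fin dloc) :
      (fun i : Fin m => Fin.append z w (Fin.castLE (Nat.le_add_right m n) i)) = z :=
    funext fun i => Fin.append_left z w i
  simp only [embed_apply (Nat.le_add_right m n), h1, h2, Matrix.one_apply]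

open scoped Kronecker in
theorem embed_eq_reindex (a : Op dloc m) :
    embed dloc m (m + n) a =
      Matrix.reindex (Fin.appendEquiv m n) (Fin.appendEquiv m n)
        (a ⊗ₖ (1 : Op dloc n)) := by
  ext x y
  obtain ⟨⟨x, x'⟩, rfl⟩ := (Fin.appendEquiv m n).surjective x
  obtain ⟨⟨y, y'⟩, rfl⟩ := (Fin.appendEquiv m n).surjective y
  rw [Matrix.reindex_apply, Matrix.submatrix_apply, Equiv.symm_apply_apply,
    Equiv.symm_apply_apply]
  exact embed_append a x y x' y'

open scoped Kronecker in
theorem trace_embed (hm : m ≤ N) (a : Op dloc m) (ha : a.trace = 0) :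
    (embed dloc m N a).trace = 0 := by
  obtain ⟨n, rfl⟩ := Nat.exists_eq_add_of_le hm
  have htrace := Matrix.trace_kronecker a (1 : Op dloc n)
  rw [ha, zero_mul] at htrace
  rw [embed_eq_reindex, ← htrace]
  exact (Fin.appendEquiv m n).symm.sum_comp fun i => (a ⊗ₖ (1 : Op dloc n)) i i

/-- A local operator and its translate to disjoint sites are uncorrelated. -/
theorem trace_embed_mul_translate (h : Op dloc k) (htr : h.trace = 0) {l : ℕ}
    (hkl : k ≤ l) (hlN : l + k ≤ N) :
    (embed dloc k N h *
      (Tmat dloc N ^ l * embed dloc k N h * (Tmat dloc N)ᴴ ^ l)).trace = 0 := by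
  have hk : k ≤ N := by omega
  set B := embed dloc k N h with hB
  have hdiag (x y : Fin N → Fin dloc) (hxy : x ≠ y) :
      B x y * B (y ∘ (finRotate N)^[l]) (x ∘ (finRotate N)^[l]) = 0 := by
    by_contra hne
    obtain ⟨h1, h2⟩ := mul_ne_zero_iff.mp hne
    simp only [hB, embed_apply hk, mul_ne_zero_iff, ne_eq, ite_eq_right_iff, one_ne_zero,
      imp_false, not_not] at h1 h2
    refine hxy (funext fun s => ?_)
    by_cases hs : k ≤ (s : ℕ)
    · exact h1.2 s hs
    · have hi : (s : ℕ) + N - l < N := by omega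
      have := h2.2 ⟨s + N - l, hi⟩ (by simp only; omega)
      have hr : (finRotate N)^[l] ⟨s + N - l, hi⟩ = s := by
        ext
        rw [coe_finRotate_iterate]
        simp only
        rw [show (s : ℕ) + N - l + l = s + N by omega, Nat.add_mod_right, Nat.mod_eq_of_lt s.isLt]
      simpa [hr] using this.symm
  have htrace : (B * (Tmat dloc N ^ l * B * (Tmat dloc N)ᴴ ^ l)).trace =
      ∑ x, B x x * B (x ∘ (finRotate N)^[l]) (x ∘ (finRotate N)^[l]) := by
    rw [Matrix.trace]
    refine Finset.sum_congr rfl fun x _ => ?_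
    rw [Matrix.diag_apply, Matrix.mul_apply]
    simp only [Tmat_pow_conj_apply]
    exact Finset.sum_eq_single x (fun y _ hy => hdiag x y hy.symm) (by simp)
  rw [htrace]
  obtain ⟨n, rfl⟩ := Nat.exists_eq_add_of_le hk
  have hindep (z z' : Fin k → Fin dloc) (w : Fin n → Fin dloc) :
      B (Fin.append z w ∘ (finRotate (k + n))^[l]) (Fin.append z w ∘ (finRotate (k + n))^[l]) =
      B (Fin.append z' w ∘ (finRotate (k + n))^[l])
        (Fin.append z' w ∘ (finRotate (k + n))^[l]) := by
    have hsites : (fun i : Fin k => Fin.append z w ((finRotate (k + n))^[l] (Fin.castLE hk i))) =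
        fun i : Fin k => Fin.append z' w ((finRotate (k + n))^[l] (Fin.castLE hk i)) := by
      funext i
      have hv := coe_finRotate_iterate l (Fin.castLE hk i)
      rw [Fin.val_castLE, Nat.mod_eq_of_lt (by omega)] at hv
      generalize (finRotate (k + n))^[l] (Fin.castLE hk i) = s at hv ⊢
      induction s using Fin.addCases with
      | left s => simp at hv; omega
      | right s => simp
    simp only [hB, embed_apply hk, Function.comp_apply, hsites]
  rw [← (Fin.appendEquiv k n).sum_comp, Fintype.sum_prod_type_right]
  refine Finset.sum_eq_zero fun w _ => ?_
  rcases isEmpty_or_nonempty (Fin k → Fin dloc) with he | ⟨⟨z₀⟩⟩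
  · simp
  · have hterm (z : Fin k → Fin dloc) : B (Fin.append z w) (Fin.append z w) = h z z := by
      rw [hB, embed_append, Matrix.one_apply_eq, mul_one]
    simp only [Fin.appendEquiv, Equiv.coe_fn_mk, hterm, hindep _ z₀ w]
    rw [← Finset.sum_mul, show ∑ z, h z z = h.trace from rfl, htr, zero_mul]

open scoped Matrix.Norms.L2Operator

/-- Embedding operators into a longer chain, as a star homomorphism. -/
noncomputable def embedStarHom (dloc m n : ℕ) : Op dloc m →⋆ₙₐ[ℂ] Op dloc (m + n) where
  toFun a := embed dloc m (m + n) a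
  map_smul' c a := by simp [embed_eq_reindex, Matrix.smul_kronecker, Matrix.submatrix_smul]
  map_zero' := by simp [embed_eq_reindex]
  map_add' a b := by simp [embed_eq_reindex, Matrix.add_kronecker, Matrix.submatrix_add]
  map_mul' a b := by
    simp only [embed_eq_reindex, Matrix.reindex_apply, Matrix.submatrix_mul_equiv,
      ← Matrix.mul_kronecker_mul, one_mul]
  map_star' a := by
    simp [embed_eq_reindex, Matrix.star_eq_conjTranspose, Matrix.conjTranspose_kronecker,
      Matrix.conjTranspose_submatrix]

theorem norm_embed_le (hm : m ≤ N) (a : Op dloc m) : ‖embed dloc m N a‖ ≤ opNorm a := by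
  obtain ⟨n, rfl⟩ := Nat.exists_eq_add_of_le hm
  exact NonUnitalStarAlgHom.norm_apply_le (embedStarHom dloc m n) a

theorem norm_translate_le (B : Op dloc N) (l : ℕ) :
    ‖Tmat dloc N ^ l * B * (Tmat dloc N)ᴴ ^ l‖ ≤ ‖B‖ := by
  have hT : Tmat dloc N ∈ unitary (Op dloc N) :=
    Unitary.mem_iff.mpr ⟨conjTranspose_mul_Tmat, Tmat_mul_conjTranspose⟩
  have h1 : Tmat dloc N ^ l ∈ unitary (Op dloc N) := pow_mem hT l
  have h2 : (Tmat dloc N)ᴴ ^ l ∈ unitary (Op dloc N) := pow_mem (Unitary.star_mem hT) l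
  rw [CStarRing.norm_mul_mem_unitary _ h2, CStarRing.norm_mem_unitary_mul _ h1]

variable {H : Op dloc N} (D : EigData dloc N H)

theorem norm_eev_le (B : Op dloc N) (j : Fin N → Fin dloc) : ‖eev D B j‖ ≤ ‖B‖ := by
  have hv : ‖(WithLp.toLp 2 (D.v j) : EuclideanSpace ℂ (Fin N → Fin dloc))‖ = 1 := by
    have h1 := D.orth j j
    rw [if_pos rfl, dotProduct_comm] at h1
    rw [norm_eq_sqrt_re_inner (𝕜 := ℂ), EuclideanSpace.inner_toLp_toLp, h1]
    simp
  have hin : eev D B j = inner ℂ (WithLp.toLp 2 (D.v j) : EuclideanSpace ℂ (Fin N → Fin dloc))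
      (Matrix.toEuclideanCLM (𝕜 := ℂ) B (WithLp.toLp 2 (D.v j))) := by
    rw [Matrix.toEuclideanCLM_toLp, EuclideanSpace.inner_toLp_toLp, dotProduct_comm]
    rfl
  rw [hin]
  refine (norm_inner_le_norm _ _).trans ?_
  rw [hv, one_mul]
  refine (ContinuousLinearMap.le_opNorm _ _).trans ?_
  rw [hv, mul_one]
  rfl

theorem sum_eev (B : Op dloc N) : ∑ j, eev D B j = B.trace := by
  set U : Op dloc N := Matrix.of fun x j => D.v j x
  have hUU : Uᴴ * U = 1 := by
    ext j j'
    rw [Matrix.one_apply, ← D.orth j j']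
    rfl
  have htr : ∑ j, eev D B j = (Uᴴ * (B * U)).trace := rfl
  rw [htr, Matrix.trace_mul_comm, mul_assoc, mul_eq_one_comm.mp hUU, mul_one]

theorem norm_trace_le (D : EigData dloc N H) (B : Op dloc N) : ‖B.trace‖ ≤ (dloc : ℝ) ^ N * ‖B‖ := by
  rw [← sum_eev D B]
  refine (norm_sum_le_of_le _ fun j _ => norm_eev_le D B j).trans ?_
  simp

/-- Expectation values in translation eigenstates are translation invariant. -/
theorem eev_translate (B : Op dloc N) (l : ℕ) (j : Fin N → Fin dloc) :
    eev D (Tmat dloc N ^ l * B * (Tmat dloc N)ᴴ ^ l) j = eev D B j := by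
  have hstar : D.τ j • (Tmat dloc N)ᴴ *ᵥ D.v j = D.v j := by
    rw [← Matrix.mulVec_smul, ← D.eigT j, Matrix.mulVec_mulVec, conjTranspose_mul_Tmat,
      Matrix.one_mulVec]
  have hnorm : star (D.τ j) * D.τ j = 1 := by
    have h1 : star (Tmat dloc N *ᵥ D.v j) ⬝ᵥ (Tmat dloc N *ᵥ D.v j) = 1 := by
      rw [Matrix.star_mulVec, ← Matrix.dotProduct_mulVec, Matrix.mulVec_mulVec,
        conjTranspose_mul_Tmat, Matrix.one_mulVec, D.orth, if_pos rfl]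
    rw [D.eigT j, star_smul, smul_dotProduct, dotProduct_smul, D.orth, if_pos rfl] at h1
    simpa using h1
  have hstar' : (Tmat dloc N)ᴴ *ᵥ D.v j = star (D.τ j) • D.v j := by
    conv_rhs => rw [← hstar]
    rw [smul_smul, hnorm, one_smul]
  have hbra : star (D.v j) ᵥ* Tmat dloc N = D.τ j • star (D.v j) := by
    have := congrArg star hstar'
    rwa [Matrix.star_mulVec, Matrix.conjTranspose_conjTranspose, star_smul, star_star] at this
  induction l with
  | zero => simp
  | succ l ih =>
    rw [Tmat_pow_succ_conj, ← ih]
    simp only [eev]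
    rw [← Matrix.mulVec_mulVec, ← Matrix.mulVec_mulVec, hstar', Matrix.dotProduct_mulVec, hbra,
      Matrix.mulVec_smul, smul_dotProduct, dotProduct_smul, smul_smul, mul_comm, hnorm, one_smul]

theorem eev_Ham {h : Op dloc k} (D : EigData dloc N (Ham dloc k N h)) (j : Fin N → Fin dloc) :
    (D.E j : ℂ) = N * eev D (embed dloc k N h) j := by
  have h1 : eev D (Ham dloc k N h) j = D.E j := by
    rw [eev, D.eigH, dotProduct_smul, D.orth, if_pos rfl, smul_eq_mul, mul_one]
  rw [← h1]
  have h2 : eev D (Ham dloc k N h) j = ∑ l : Fin N,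
      eev D (Tmat dloc N ^ (l : ℕ) * embed dloc k N h * (Tmat dloc N)ᴴ ^ (l : ℕ)) j := by
    simp only [eev, Ham, Matrix.sum_mulVec, dotProduct_sum]
  simp [h2, eev_translate]

theorem abs_energy_density_le {h : Op dloc k} (hkN : k ≤ N) (hN : 0 < N) (hnorm : opNorm h = 1)
    (D : EigData dloc N (Ham dloc k N h)) (j : Fin N → Fin dloc) : |D.E j / N| ≤ 1 := by
  have hN' : (0 : ℝ) < N := by exact_mod_cast hN
  have h1 : ‖(D.E j : ℂ)‖ ≤ N * 1 := by
    rw [eev_Ham D j, norm_mul, Complex.norm_natCast]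
    gcongr
    exact (norm_eev_le D _ j).trans ((norm_embed_le hkN h).trans hnorm.le)
  rw [Complex.norm_real, Real.norm_eq_abs, mul_one] at h1
  rwa [abs_div, abs_of_pos hN', div_le_one hN']

/-- The variance of the energy density is of order `1 / N`. -/
theorem sum_energy_density_sq_le {h : Op dloc k} (hkN : k ≤ N) (hN : 0 < N) (htr : h.trace = 0)
    (hnorm : opNorm h = 1) (D : EigData dloc N (Ham dloc k N h)) :
    ∑ j, (D.E j / N) ^ 2 ≤ 2 * k * (dloc : ℝ) ^ N / N := by
  have hN' : (0 : ℝ) < N := by exact_mod_cast hN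
  set B := embed dloc k N h with hB
  have hBn : ‖B‖ ≤ 1 := (norm_embed_le hkN h).trans hnorm.le
  have hterm (j : Fin N → Fin dloc) :
      (((D.E j / N) ^ 2 : ℝ) : ℂ) = (N : ℂ)⁻¹ * eev D (B * Ham dloc k N h) j := by
    have hNc : (N : ℂ) ≠ 0 := by exact_mod_cast hN.ne'
    have h1 : eev D (B * Ham dloc k N h) j = D.E j * eev D B j := by
      rw [eev, ← Matrix.mulVec_mulVec, D.eigH, Matrix.mulVec_smul, dotProduct_smul, smul_eq_mul]
      rfl
    have h2 : eev D B j = D.E j / N := by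
      rw [eev_Ham D j, mul_div_cancel_left₀ _ hNc]
    rw [h1, h2]
    push_cast
    field_simp
  have hsum : ((∑ j, (D.E j / N) ^ 2 : ℝ) : ℂ) = (N : ℂ)⁻¹ *
      ∑ l : Fin N, (B * (Tmat dloc N ^ (l : ℕ) * B * (Tmat dloc N)ᴴ ^ (l : ℕ))).trace := by
    rw [Complex.ofReal_sum, Finset.sum_congr rfl fun j _ => hterm j, ← Finset.mul_sum, sum_eev,
      Ham, Finset.mul_sum, Matrix.trace_sum]
  have hbound : ‖∑ l : Fin N,
      (B * (Tmat dloc N ^ (l : ℕ) * B * (Tmat dloc N)ᴴ ^ (l : ℕ))).trace‖ ≤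
      2 * k * (dloc : ℝ) ^ N := by
    rw [Fin.sum_univ_eq_sum_range
      (fun l => (B * (Tmat dloc N ^ l * B * (Tmat dloc N)ᴴ ^ l)).trace) N]
    rw [← Finset.sum_subset (s₁ := Finset.range k ∪ Finset.Ico (N - k) N)]
    · refine (norm_sum_le_of_le (f := fun l : ℕ => _) _ (n := fun _ => (dloc : ℝ) ^ N)
        fun l _ => ?_).trans ?_
      · refine (norm_trace_le D _).trans (mul_le_of_le_one_right (by positivity) ?_)
        refine (norm_mul_le _ _).trans (mul_le_one₀ hBn (norm_nonneg _) ?_)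
        exact (norm_translate_le B l).trans hBn
      · rw [Finset.sum_const, nsmul_eq_mul]
        gcongr
        have hc := Finset.card_union_le (Finset.range k) (Finset.Ico (N - k) N)
        rw [Finset.card_range, Nat.card_Ico] at hc
        exact_mod_cast (show _ ≤ 2 * k by omega)
    · intro l hl
      simp only [Finset.mem_union, Finset.mem_range, Finset.mem_Ico] at hl ⊢
      omega
    · intro l hl hl'
      simp only [Finset.mem_union, Finset.mem_range, Finset.mem_Ico] at hl hl'
      exact trace_embed_mul_translate h htr (by omega) (by omega)
  have h0 : 0 ≤ ∑ j, (D.E j / N) ^ 2 := by positivity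
  calc ∑ j, (D.E j / N) ^ 2 = ‖((∑ j, (D.E j / N) ^ 2 : ℝ) : ℂ)‖ := by
        rw [Complex.norm_real, Real.norm_of_nonneg h0]
    _ ≤ (N : ℝ)⁻¹ * (2 * k * (dloc : ℝ) ^ N) := by
        rw [hsum, norm_mul, norm_inv, Complex.norm_natCast]
        gcongr
    _ = 2 * k * (dloc : ℝ) ^ N / N := by ring

end ChainOperators

theorem SmoothFn.norm_sub_le {f : ℝ → ℂ} {c0 c1 c2 : ℂ} {M : ℝ} (hf : SmoothFn f c0 c1 c2 M)
    {x : ℝ} (hx : |x| ≤ 1) : ‖f x - c0‖ ≤ (‖c1‖ + ‖c2‖ / 2 + M) * |x| := by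
  have h3 := hf.2.2 x (abs_le.mp hx)
  have hM := hf.1
  have hx0 := abs_nonneg x
  have hx2 : |x| ^ 2 ≤ |x| := pow_le_of_le_one hx0 hx two_ne_zero
  have hx3 : |x| ^ 3 ≤ |x| := pow_le_of_le_one hx0 hx three_ne_zero
  calc ‖f x - c0‖ = ‖(f x - c0 - c1 * x - c2 / 2 * x ^ 2) + c1 * x + c2 / 2 * x ^ 2‖ := by
        congr 1; ring
    _ ≤ M * |x| ^ 3 + ‖c1‖ * |x| + ‖c2‖ / 2 * |x| ^ 2 := by
        refine (norm_add₃_le).trans ?_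
        simp only [norm_mul, norm_div, norm_pow, Complex.norm_real, Real.norm_eq_abs,
          Complex.norm_ofNat] at h3 ⊢
        gcongr
    _ ≤ M * |x| + ‖c1‖ * |x| + ‖c2‖ / 2 * |x| := by gcongr
    _ = (‖c1‖ + ‖c2‖ / 2 + M) * |x| := by ring

/-- The arithmetic mean is at most the root mean square. -/
theorem norm_mean_le_sqrt_mean_sq {ι : Type*} [Fintype ι] {d : ℝ} (hd : 0 < d)
    (hcard : (Fintype.card ι : ℝ) = d) (g : ι → ℂ) :
    ‖∑ j, g j‖ / d ≤ √((1 / d) * ∑ j, ‖g j‖ ^ 2) := by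
  refine Real.le_sqrt_of_sq_le ?_
  have h1 : (∑ j, ‖g j‖) ^ 2 ≤ d * ∑ j, ‖g j‖ ^ 2 := by
    simpa [hcard] using sq_sum_le_card_mul_sum_sq (s := Finset.univ) (f := fun j => ‖g j‖)
  calc (‖∑ j, g j‖ / d) ^ 2 ≤ ((∑ j, ‖g j‖) / d) ^ 2 := by gcongr; exact norm_sum_le _ _
    _ = (∑ j, ‖g j‖) ^ 2 / d ^ 2 := by rw [div_pow]
    _ ≤ (d * ∑ j, ‖g j‖ ^ 2) / d ^ 2 := by gcongr
    _ = (1 / d) * ∑ j, ‖g j‖ ^ 2 := by field_simp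

theorem norm_taylor_const_le {dloc k k' N : ℕ} (hdloc : 0 < dloc) {h : Op dloc k}
    (htr : h.trace = 0) (hnorm : opNorm h = 1) (D : EigData dloc N (Ham dloc k N h))
    {A : Op dloc k'} (hAtr : A.trace = 0) {f : ℝ → ℂ} {c0 c1 c2 : ℂ} {M : ℝ}
    (hf : SmoothFn f c0 c1 c2 M) (hkN : k ≤ N) (hk'N : k' ≤ N) (hN : 0 < N) :
    ‖c0‖ ≤ (‖c1‖ + ‖c2‖ / 2 + M) * √(2 * k / N) + rf D (embed dloc k' N A) f := by
  set d : ℝ := (dloc : ℝ) ^ N with hd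
  have hd0 : 0 < d := by positivity
  have hcard : (Fintype.card (Fin N → Fin dloc) : ℝ) = d := by simp [hd]
  set C := ‖c1‖ + ‖c2‖ / 2 + M
  have hC0 : 0 ≤ C := add_nonneg (by positivity) hf.1
  set B := embed dloc k' N A
  have hdecomp : (d : ℂ) * c0 =
      -(∑ j, (f (D.E j / N) - c0)) - ∑ j, (eev D B j - f (D.E j / N)) := by
    have hc : ∑ _j : Fin N → Fin dloc, c0 = (d : ℂ) * c0 := by
      rw [Finset.sum_const, nsmul_eq_mul, Finset.card_univ, ← hcard, Complex.ofReal_natCast]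
    rw [Finset.sum_sub_distrib, Finset.sum_sub_distrib, sum_eev, trace_embed hk'N A hAtr, hc]
    ring
  have hfirst : √((1 / d) * ∑ j, ‖f (D.E j / N) - c0‖ ^ 2) ≤ C * √(2 * k / N) := by
    rw [← Real.sqrt_sq hC0, ← Real.sqrt_mul (sq_nonneg C)]
    refine Real.sqrt_le_sqrt ?_
    calc (1 / d) * ∑ j, ‖f (D.E j / N) - c0‖ ^ 2
        ≤ (1 / d) * ∑ j, C ^ 2 * (D.E j / N) ^ 2 := by
          gcongr with j
          rw [← sq_abs (D.E j / N), ← mul_pow]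
          gcongr
          exact hf.norm_sub_le (abs_energy_density_le hkN hN hnorm D j)
      _ = C ^ 2 * ((1 / d) * ∑ j, (D.E j / N) ^ 2) := by rw [← Finset.mul_sum]; ring
      _ ≤ C ^ 2 * ((1 / d) * (2 * k * d / N)) := by
          gcongr
          exact sum_energy_density_sq_le hkN hN htr hnorm D
      _ = C ^ 2 * (2 * k / N) := by field_simp
  calc ‖c0‖ = ‖(d : ℂ) * c0‖ / d := by
        rw [norm_mul, Complex.norm_real, Real.norm_of_nonneg hd0.le, mul_div_cancel_left₀ _ hd0.ne']
    _ ≤ ‖∑ j, (f (D.E j / N) - c0)‖ / d + ‖∑ j, (eev D B j - f (D.E j / N))‖ / d := by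
        rw [hdecomp, ← add_div]
        gcongr
        exact (norm_sub_le _ _).trans_eq (by rw [norm_neg])
    _ ≤ C * √(2 * k / N) + rf D B f :=
        add_le_add ((norm_mean_le_sqrt_mean_sq hd0 hcard _).trans hfirst)
          (norm_mean_le_sqrt_mean_sq hd0 hcard _)

/-- If `A` is traceless with `‖A‖ = 1`, `f` is smooth, and `r_f(N_i) → 0`
along a strictly increasing sequence `N_i`, then `f(0) = 0`. -/
theorem taylor_const_eq_zero (dloc k k' : ℕ) (hdloc : 2 ≤ dloc) (hk : 1 ≤ k)
    (h : Op dloc k) (hherm : h.IsHermitian) (htr : h.trace = 0) (hnorm : opNorm h = 1)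
    (D : ∀ N, EigData dloc N (Ham dloc k N h))
    (A : Op dloc k') (hAtr : A.trace = 0) (hAnorm : opNorm A = 1)
    (f : ℝ → ℂ) (c0 c1 c2 : ℂ) (M : ℝ) (hf : SmoothFn f c0 c1 c2 M)
    (Ni : ℕ → ℕ) (hmono : StrictMono Ni)
    (hlim : Filter.Tendsto (fun i => rf (D (Ni i)) (embed dloc k' (Ni i) A) f)
      Filter.atTop (nhds 0)) :
    c0 = 0 := by
  have hNi : Tendsto Ni atTop atTop := hmono.tendsto_atTop
  have hsqrt : Tendsto (fun i => √(2 * k / (Ni i : ℝ))) atTop (nhds 0) := by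
    have h1 : Tendsto (fun i => 2 * (k : ℝ) / (Ni i : ℝ)) atTop (nhds 0) :=
      (tendsto_natCast_atTop_atTop.comp hNi).const_div_atTop _
    simpa using h1.sqrt
  have hbound := (hsqrt.const_mul (‖c1‖ + ‖c2‖ / 2 + M)).add hlim
  rw [mul_zero, add_zero] at hbound
  have hle : ‖c0‖ ≤ 0 := by
    refine ge_of_tendsto hbound ?_
    filter_upwards [hNi.eventually_ge_atTop k, hNi.eventually_ge_atTop k',
      hNi.eventually_gt_atTop 0] with i hik hik' hi0
    exact norm_taylor_const_le (by omega) htr hnorm (D (Ni i)) hAtr hf hik hik' hi0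
  exact norm_le_zero_iff.mp hle
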